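/- (Theorem 6, supervised setting) The min-max regret for supervised batch learning under the misspecification setting equals R*_N(Θ, Φ) = max over priors π on F of ( I_π(Y_N; Φ | X^N, Y^{N-1}) − Σ_φ π(φ) D_c(P_φ ‖ Θ) ); moreover, for each prior π the infimum over supervised predictors of the π-averaged regret is attained at the mixture predictor Q_π(y_N | x^N, y^{N-1}) = ( Σ_φ π(φ) Π_{n=1}^{N} P_φ(y_n | x_n) ) / ( Σ_φ π(φ) Π_{n=1}^{N-1} P_φ(y_n | x_n) ). -/

import Mathlib

/-!
Statement 14 (Theorem 6, supervised setting). Feature sequences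
`x^N : Fin (n+1) → X` are i.i.d. from a known strictly positive `P_X`; labels
are generated memorylessly by a channel model `P_φ(y|x)`. The min-max regret of
supervised batch learning under the misspecification setting equals
`max_π ( I_π(Y_N; Φ | X^N, Y^{N-1}) − Σ_φ π(φ) D_c(P_φ ‖ Θ) )`, and for each
prior `π` the infimum over supervised predictors of the π-averaged regret is
attained at the mixture predictor `Q_π`.
-/

noncomputable section

/-- A strictly positive probability mass function on a finite type. -/
def IsPMF {X : Type*} [Fintype X] (p : X → ℝ) : Prop :=
  (∀ x, 0 < p x) ∧ (∑ x, p x) = 1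

/-- A channel model: to every feature `x` it assigns a strictly positive
probability function on labels `Y`. -/
def IsChannel {X Y : Type*} [Fintype Y] (W : X → Y → ℝ) : Prop :=
  ∀ x, (∀ y, 0 < W x y) ∧ (∑ y, W x y) = 1

/-- A supervised predictor: to every `(x^N, y^{N-1})` it assigns a strictly
positive probability function on `Y`. -/
def IsSupPredictor {X Y : Type*} [Fintype Y] {n : ℕ}
    (Q : (Fin (n + 1) → X) → (Fin n → Y) → Y → ℝ) : Prop :=
  ∀ x z, (∀ y, 0 < Q x z y) ∧ (∑ y, Q x z y) = 1

/-- A prior: a probability vector on the index set `F`. -/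
def IsPrior {F : Type*} [Fintype F] (π : F → ℝ) : Prop :=
  (∀ φ, 0 ≤ π φ) ∧ (∑ φ, π φ) = 1

/-- `P(x^N) = Π_n P_X(x_n)`. -/
def featProb {X : Type*} {n : ℕ} (pX : X → ℝ) (x : Fin (n + 1) → X) : ℝ :=
  ∏ i, pX (x i)

/-- `P_φ(y^N | x^N) = Π_n P_φ(y_n | x_n)`. -/
def chanProd {X Y : Type*} {n : ℕ} (W : X → Y → ℝ)
    (x : Fin (n + 1) → X) (y : Fin (n + 1) → Y) : ℝ :=
  ∏ i, W (x i) (y i)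

/-- The supervised regret
`R(P_φ, P_θ, Q) = Σ_{x^N} Σ_{y^N} P(x^N) P_φ(y^N|x^N)
  log( P_θ(y_N|x_N) / Q(y_N|x^N,y^{N-1}) )`. -/
def supRegret {X Y : Type*} [Fintype X] [Fintype Y] {n : ℕ}
    (pX : X → ℝ) (Wφ Wθ : X → Y → ℝ)
    (Q : (Fin (n + 1) → X) → (Fin n → Y) → Y → ℝ) : ℝ :=
  ∑ x : Fin (n + 1) → X, ∑ y : Fin (n + 1) → Y,
    featProb pX x * chanProd Wφ x y *
      Real.log (Wθ (x (Fin.last n)) (y (Fin.last n)) /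
        Q x (Fin.init y) (y (Fin.last n)))

/-- The single-letter conditional divergence
`D_c(P_φ ‖ P_θ) = Σ_x Σ_y P_X(x) P_φ(y|x) log( P_φ(y|x) / P_θ(y|x) )`. -/
def DcSup {X Y : Type*} [Fintype X] [Fintype Y]
    (pX : X → ℝ) (Wφ Wθ : X → Y → ℝ) : ℝ :=
  ∑ x, ∑ y, pX x * Wφ x y * Real.log (Wφ x y / Wθ x y)

/-- `D_c(P_φ ‖ Θ) = min_{θ ∈ G} D_c(P_φ ‖ P_θ)`. -/
def DcSupSet {X Y F : Type*} [Fintype X] [Fintype Y] [Fintype F]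
    (pX : X → ℝ) (W : F → X → Y → ℝ) (G : Finset F) (hG : G.Nonempty)
    (Wφ : X → Y → ℝ) : ℝ :=
  G.inf' hG fun θ => DcSup pX Wφ (W θ)

/-- The mixture supervised predictor
`Q_π(y_N | x^N, y^{N-1}) = ( Σ_φ π(φ) Π_{n=1}^{N} P_φ(y_n|x_n) ) /
  ( Σ_φ π(φ) Π_{n=1}^{N-1} P_φ(y_n|x_n) )`. -/
def mixSupPred {X Y F : Type*} [Fintype Y] [Fintype F] {n : ℕ}
    (W : F → X → Y → ℝ) (π : F → ℝ) :
    (Fin (n + 1) → X) → (Fin n → Y) → Y → ℝ :=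
  fun x z y =>
    (∑ φ, π φ * ∏ i, W φ (x i) ((Fin.snoc z y : Fin (n + 1) → Y) i)) /
      (∑ φ, π φ * ∏ i : Fin n, W φ (x i.castSucc) (z i))

/-- The first (Q-dependent) term of the supervised regret decomposition:
`Σ_{x^N} Σ_{y^N} P(x^N) P_φ(y^N|x^N) log( P_φ(y_N|x_N) / Q(y_N|x^N,y^{N-1}) )`. -/
def DcSupPred {X Y : Type*} [Fintype X] [Fintype Y] {n : ℕ}
    (pX : X → ℝ) (Wφ : X → Y → ℝ)
    (Q : (Fin (n + 1) → X) → (Fin n → Y) → Y → ℝ) : ℝ :=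
  ∑ x : Fin (n + 1) → X, ∑ y : Fin (n + 1) → Y,
    featProb pX x * chanProd Wφ x y *
      Real.log (Wφ (x (Fin.last n)) (y (Fin.last n)) /
        Q x (Fin.init y) (y (Fin.last n)))

/-- `I_π(Y_N; Φ | X^N, Y^{N-1})`. -/
def mutualInfoSup {X Y F : Type*} [Fintype X] [Fintype Y] [Fintype F] {n : ℕ}
    (pX : X → ℝ) (W : F → X → Y → ℝ) (π : F → ℝ) : ℝ :=
  ∑ φ, ∑ x : Fin (n + 1) → X, ∑ y : Fin (n + 1) → Y,
    π φ * featProb pX x * chanProd (W φ) x y *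
      Real.log (W φ (x (Fin.last n)) (y (Fin.last n)) /
        mixSupPred W π x (Fin.init y) (y (Fin.last n)))

/-- The supervised min-max regret
`R*_N(Θ, Φ) = inf_Q max_{φ ∈ F} max_{θ ∈ G} R(P_φ, P_θ, Q)`. -/
def RstarSup {X Y F : Type*} [Fintype X] [Fintype Y] [Fintype F] [Nonempty F]
    {n : ℕ} (pX : X → ℝ) (W : F → X → Y → ℝ) (G : Finset F) (hG : G.Nonempty) : ℝ :=
  sInf {r : ℝ | ∃ Q : (Fin (n + 1) → X) → (Fin n → Y) → Y → ℝ,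
    IsSupPredictor Q ∧
    r = Finset.univ.sup' Finset.univ_nonempty fun φ =>
          G.sup' hG fun θ => supRegret pX (W φ) (W θ) Q}

/-- A sum over `(n + 1)`-tuples splits off the last coordinate. -/
lemma sum_fin_snoc {Y : Type*} [Fintype Y] {n : ℕ} (g : (Fin (n + 1) → Y) → ℝ) :
    ∑ y, g y = ∑ z : Fin n → Y, ∑ a, g (Fin.snoc z a : Fin (n + 1) → Y) := by
  rw [← (Fin.snocEquiv fun _ : Fin (n + 1) => Y).sum_comp, Fintype.sum_prod_type_right]
  rfl

/-- Product distributions have total mass one. -/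
lemma sum_prod_eq_one {ι Y : Type*} [Fintype ι] [DecidableEq ι] [Fintype Y]
    (p : ι → Y → ℝ) (hp : ∀ i, ∑ y, p i y = 1) : ∑ z : ι → Y, ∏ i, p i (z i) = 1 := by
  have h := Finset.prod_univ_sum (fun _ : ι => (Finset.univ : Finset Y)) p
  rw [Fintype.piFinset_univ] at h
  rw [← h]
  exact Finset.prod_eq_one fun i _ => hp i

/-- Expectations of functions of the last pair are single-letter expectations. -/
lemma sum_featProb_chanProd_last {X Y : Type*} [Fintype X] [Fintype Y] {n : ℕ}
    {pX : X → ℝ} (hpX : IsPMF pX) {V : X → Y → ℝ} (hV : IsChannel V) (f : X → Y → ℝ) :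
    ∑ x : Fin (n + 1) → X, ∑ y : Fin (n + 1) → Y,
      featProb pX x * chanProd V x y * f (x (Fin.last n)) (y (Fin.last n)) =
      ∑ x, ∑ y, pX x * V x y * f x y := by
  have hy (x : Fin (n + 1) → X) :
      ∑ y : Fin (n + 1) → Y,
        featProb pX x * chanProd V x y * f (x (Fin.last n)) (y (Fin.last n)) =
      featProb pX x * ∑ b, V (x (Fin.last n)) b * f (x (Fin.last n)) b := by
    have h1 : ∑ z : Fin n → Y, ∏ i, V (x i.castSucc) (z i) = 1 :=
      sum_prod_eq_one (fun i : Fin n => V (x i.castSucc)) fun i => (hV _).2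
    rw [sum_fin_snoc, ← one_mul (∑ b, V (x (Fin.last n)) b * _), ← h1, Finset.sum_mul_sum, Finset.mul_sum]
    refine Finset.sum_congr rfl fun z _ => ?_
    rw [Finset.mul_sum]
    refine Finset.sum_congr rfl fun b _ => ?_
    simp only [chanProd, Fin.prod_univ_castSucc, Fin.snoc_castSucc, Fin.snoc_last]
    ring
  simp_rw [hy]
  have h2 : ∑ z : Fin n → X, ∏ i, pX (z i) = 1 :=
    sum_prod_eq_one (fun _ => pX) fun _ => hpX.2
  rw [sum_fin_snoc, ← one_mul (∑ x, ∑ y, pX x * V x y * f x y), ← h2, Finset.sum_mul_sum]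
  refine Finset.sum_congr rfl fun z _ => Finset.sum_congr rfl fun a _ => ?_
  simp only [featProb, Fin.prod_univ_castSucc, Fin.snoc_castSucc, Fin.snoc_last]
  rw [mul_assoc, Finset.mul_sum]
  simp only [mul_assoc]

/-- The regret is the predictive divergence minus the single-letter divergence. -/
lemma supRegret_eq {X Y : Type*} [Fintype X] [Fintype Y] {n : ℕ}
    {pX : X → ℝ} (hpX : IsPMF pX) {V U : X → Y → ℝ} (hV : IsChannel V) (hU : IsChannel U)
    {Q : (Fin (n + 1) → X) → (Fin n → Y) → Y → ℝ} (hQ : IsSupPredictor Q) :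
    supRegret pX V U Q = DcSupPred pX V Q - DcSup pX V U := by
  rw [DcSup, ← sum_featProb_chanProd_last (n := n) hpX hV fun x y => Real.log (V x y / U x y),
    DcSupPred, supRegret]
  simp only [← Finset.sum_sub_distrib]
  refine Finset.sum_congr rfl fun x _ => Finset.sum_congr rfl fun y _ => ?_
  rw [Real.log_div ((hU _).1 _).ne' ((hQ _ _).1 _).ne',
    Real.log_div ((hV _).1 _).ne' ((hQ _ _).1 _).ne',
    Real.log_div ((hV _).1 _).ne' ((hU _).1 _).ne']
  ring

lemma sup'_supRegret {X Y F : Type*} [Fintype X] [Fintype Y] [Fintype F] {n : ℕ}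
    {pX : X → ℝ} (hpX : IsPMF pX) {W : F → X → Y → ℝ} (hW : ∀ φ, IsChannel (W φ))
    (G : Finset F) (hG : G.Nonempty) (φ : F)
    {Q : (Fin (n + 1) → X) → (Fin n → Y) → Y → ℝ} (hQ : IsSupPredictor Q) :
    (G.sup' hG fun θ => supRegret pX (W φ) (W θ) Q) =
      DcSupPred pX (W φ) Q - DcSupSet pX W G hG (W φ) := by
  simp only [supRegret_eq hpX (hW φ) (hW _) hQ, DcSupSet]
  apply le_antisymm
  · refine Finset.sup'_le _ _ fun θ hθ => ?_
    gcongr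
    exact Finset.inf'_le _ hθ
  · obtain ⟨θ, hθ, h⟩ := Finset.exists_mem_eq_inf' hG fun θ => DcSup pX (W φ) (W θ)
    rw [h]
    exact Finset.le_sup' (fun θ => DcSupPred pX (W φ) Q - DcSup pX (W φ) (W θ)) hθ

lemma IsPrior.sum_mul_pos {F : Type*} [Fintype F] {π : F → ℝ} (hπ : IsPrior π)
    {g : F → ℝ} (hg : ∀ φ, 0 < g φ) : 0 < ∑ φ, π φ * g φ := by
  obtain ⟨φ, -, hφ⟩ : ∃ φ ∈ Finset.univ, 0 < π φ := by
    by_contra! h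
    have := Finset.sum_nonpos h
    rw [hπ.2] at this
    linarith
  exact Finset.sum_pos' (fun ψ _ => mul_nonneg (hπ.1 ψ) (hg ψ).le)
    ⟨φ, Finset.mem_univ _, mul_pos hφ (hg φ)⟩

/-- The mixture probability of the first `n` labels. -/
def mixPast {X Y F : Type*} [Fintype F] {n : ℕ} (W : F → X → Y → ℝ) (π : F → ℝ)
    (x : Fin (n + 1) → X) (z : Fin n → Y) : ℝ :=
  ∑ φ, π φ * ∏ i : Fin n, W φ (x i.castSucc) (z i)

section Mixture

variable {X Y F : Type*} [Fintype Y] [Fintype F] {n : ℕ}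
  {W : F → X → Y → ℝ} {π : F → ℝ}

lemma mixPast_pos (hW : ∀ φ, IsChannel (W φ)) (hπ : IsPrior π)
    (x : Fin (n + 1) → X) (z : Fin n → Y) : 0 < mixPast W π x z :=
  hπ.sum_mul_pos fun φ => Finset.prod_pos fun _ _ => (hW φ _).1 _

lemma mixPast_mul_mixSupPred (hW : ∀ φ, IsChannel (W φ)) (hπ : IsPrior π)
    (x : Fin (n + 1) → X) (z : Fin n → Y) (a : Y) :
    mixPast W π x z * mixSupPred W π x z a = ∑ φ, π φ * chanProd (W φ) x (Fin.snoc z a) :=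
  mul_div_cancel₀ _ (mixPast_pos hW hπ x z).ne'

lemma isSupPredictor_mixSupPred (hW : ∀ φ, IsChannel (W φ)) (hπ : IsPrior π) :
    IsSupPredictor (mixSupPred (n := n) W π) := by
  refine fun x z => ⟨fun y => div_pos ?_ (mixPast_pos hW hπ x z), ?_⟩
  · exact hπ.sum_mul_pos fun φ => Finset.prod_pos fun _ _ => (hW φ _).1 _
  · apply mul_left_cancel₀ (mixPast_pos hW hπ x z).ne'
    rw [Finset.mul_sum, mul_one]
    simp only [mixPast_mul_mixSupPred hW hπ]
    rw [Finset.sum_comm]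
    refine Finset.sum_congr rfl fun φ _ => ?_
    simp only [chanProd, Fin.prod_univ_castSucc, Fin.snoc_castSucc, Fin.snoc_last]
    rw [← Finset.mul_sum, ← Finset.mul_sum, (hW φ _).2, mul_one]

variable [Fintype X] {pX : X → ℝ}

/-- The mixture predictor minimizes the averaged predictive divergence. -/
lemma sum_DcSupPred_mixSupPred_le (hpX : IsPMF pX) (hW : ∀ φ, IsChannel (W φ))
    (hπ : IsPrior π) {Q : (Fin (n + 1) → X) → (Fin n → Y) → Y → ℝ} (hQ : IsSupPredictor Q) :
    ∑ φ, π φ * DcSupPred pX (W φ) (mixSupPred (n := n) W π) ≤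
      ∑ φ, π φ * DcSupPred pX (W φ) Q := by
  have hM := isSupPredictor_mixSupPred (n := n) hW hπ
  have hdiff : ∑ φ, π φ * DcSupPred pX (W φ) Q -
      ∑ φ, π φ * DcSupPred pX (W φ) (mixSupPred (n := n) W π) =
      ∑ x : Fin (n + 1) → X, featProb pX x * ∑ z : Fin n → Y, ∑ a,
        mixPast W π x z * mixSupPred W π x z a *
          Real.log (mixSupPred W π x z a / Q x z a) := by
    have key (φ : F) : π φ * DcSupPred pX (W φ) Q -
        π φ * DcSupPred pX (W φ) (mixSupPred (n := n) W π) =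
        ∑ x : Fin (n + 1) → X, ∑ z : Fin n → Y, ∑ a, featProb pX x *
          ((π φ * chanProd (W φ) x (Fin.snoc z a)) *
            Real.log (mixSupPred W π x z a / Q x z a)) := by
      rw [← mul_sub, DcSupPred, DcSupPred, ← Finset.sum_sub_distrib, Finset.mul_sum]
      refine Finset.sum_congr rfl fun x _ => ?_
      rw [sum_fin_snoc, sum_fin_snoc, ← Finset.sum_sub_distrib, Finset.mul_sum]
      refine Finset.sum_congr rfl fun z _ => ?_
      rw [← Finset.sum_sub_distrib, Finset.mul_sum]
      refine Finset.sum_congr rfl fun a _ => ?_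
      simp only [Fin.init_snoc, Fin.snoc_last]
      rw [Real.log_div ((hW φ _).1 _).ne' ((hQ _ _).1 _).ne',
        Real.log_div ((hW φ _).1 _).ne' ((hM _ _).1 _).ne',
        Real.log_div ((hM _ _).1 _).ne' ((hQ _ _).1 _).ne']
      ring
    simp only [← Finset.sum_sub_distrib, key]
    rw [Finset.sum_comm]
    refine Finset.sum_congr rfl fun x _ => ?_
    rw [Finset.sum_comm, Finset.mul_sum]
    refine Finset.sum_congr rfl fun z _ => ?_
    rw [Finset.sum_comm, Finset.mul_sum]
    refine Finset.sum_congr rfl fun a _ => ?_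
    rw [mixPast_mul_mixSupPred hW hπ, Finset.sum_mul, Finset.mul_sum]
  rw [← sub_nonneg, hdiff]
  refine Finset.sum_nonneg fun x _ =>
    mul_nonneg (Finset.prod_nonneg fun i _ => (hpX.1 _).le) (Finset.sum_nonneg fun z _ => ?_)
  have hbound (a : Y) : mixPast W π x z * (mixSupPred W π x z a - Q x z a) ≤
      mixPast W π x z * mixSupPred W π x z a *
        Real.log (mixSupPred W π x z a / Q x z a) := by
    have hm := (hM x z).1 a
    have hq := (hQ x z).1 a
    have h := Real.one_sub_inv_le_log_of_pos (div_pos hm hq)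
    rw [mul_assoc]
    refine mul_le_mul_of_nonneg_left ?_ (mixPast_pos hW hπ x z).le
    calc mixSupPred W π x z a - Q x z a
        = mixSupPred W π x z a * (1 - (mixSupPred W π x z a / Q x z a)⁻¹) := by
          field_simp
      _ ≤ _ := mul_le_mul_of_nonneg_left h hm.le
  calc (0 : ℝ) = ∑ a, mixPast W π x z * (mixSupPred W π x z a - Q x z a) := by
        rw [← Finset.mul_sum, Finset.sum_sub_distrib, (hM x z).2, (hQ x z).2, sub_self, mul_zero]
    _ ≤ _ := Finset.sum_le_sum fun a _ => hbound a

lemma mutualInfoSup_eq :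
    mutualInfoSup (n := n) pX W π =
      ∑ φ, π φ * DcSupPred pX (W φ) (mixSupPred (n := n) W π) := by
  simp only [mutualInfoSup, DcSupPred, Finset.mul_sum, mul_assoc]

lemma continuousOn_DcSupPred_mixSupPred (hW : ∀ φ, IsChannel (W φ)) (φ : F) :
    ContinuousOn (fun π => DcSupPred pX (W φ) (mixSupPred (n := n) W π)) (stdSimplex ℝ F) := by
  unfold DcSupPred
  refine continuousOn_finsetSum _ fun x _ => continuousOn_finsetSum _ fun y _ =>
    continuousOn_const.mul (ContinuousOn.log (continuousOn_const.div
      (ContinuousOn.div (by fun_prop) (by fun_prop) fun π hπ => ?_) fun π hπ => ?_) fun π hπ => ?_)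
  · exact (mixPast_pos hW hπ x (Fin.init y)).ne'
  · exact ((isSupPredictor_mixSupPred hW hπ x _).1 _).ne'
  · exact (div_pos ((hW φ _).1 _) ((isSupPredictor_mixSupPred hW hπ x _).1 _)).ne'

/-- At a prior maximizing the Bayes value, the mixture predictor equalizes the regrets from
above: no channel exceeds the Bayes value. -/
lemma DcSupPred_sub_le_of_isMaxOn (hpX : IsPMF pX) (hW : ∀ φ, IsChannel (W φ))
    (d : F → ℝ) (hπ : IsPrior π)
    (hmax : IsMaxOn (fun ρ => ∑ φ, ρ φ *
      (DcSupPred pX (W φ) (mixSupPred (n := n) W ρ) - d φ)) (stdSimplex ℝ F) π) (ψ : F) :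
    DcSupPred pX (W ψ) (mixSupPred (n := n) W π) - d ψ ≤
      ∑ φ, π φ * (DcSupPred pX (W φ) (mixSupPred (n := n) W π) - d φ) := by
  classical
  let γ : ℝ → F → ℝ := fun t => (1 - t) • π + t • Pi.single ψ 1
  have hγ : ∀ t ∈ Set.Icc (0 : ℝ) 1, γ t ∈ stdSimplex ℝ F := fun t ht =>
    convex_stdSimplex ℝ F hπ (single_mem_stdSimplex ℝ ψ) (by linarith [ht.2]) ht.1 (by ring)
  have hγ0 : γ 0 = π := by simp [γ]
  have hcont : ContinuousOn
      (fun t => DcSupPred pX (W ψ) (mixSupPred (n := n) W (γ t)) - d ψ) (Set.Icc 0 1) :=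
    ((continuousOn_DcSupPred_mixSupPred hW ψ).comp (by fun_prop) hγ).sub continuousOn_const
  have hle : ∀ t ∈ Set.Ioc (0 : ℝ) 1,
      DcSupPred pX (W ψ) (mixSupPred (n := n) W (γ t)) - d ψ ≤
      ∑ φ, π φ * (DcSupPred pX (W φ) (mixSupPred (n := n) W π) - d φ) := by
    intro t ht
    have h1 := hmax (hγ t ⟨ht.1.le, ht.2⟩)
    have h2 := sum_DcSupPred_mixSupPred_le hpX hW hπ
      (isSupPredictor_mixSupPred (n := n) hW (hγ t ⟨ht.1.le, ht.2⟩))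
    have h3 : ∑ φ, γ t φ * (DcSupPred pX (W φ) (mixSupPred (n := n) W (γ t)) - d φ) =
        (1 - t) * ∑ φ, π φ * (DcSupPred pX (W φ) (mixSupPred (n := n) W (γ t)) - d φ) +
        t * (DcSupPred pX (W ψ) (mixSupPred (n := n) W (γ t)) - d ψ) := by
      simp [γ, add_mul, Finset.sum_add_distrib, Finset.mul_sum, mul_assoc, Pi.single_apply]
    simp only [Set.mem_ofPred_eq, h3] at h1
    simp only [mul_sub, Finset.sum_sub_distrib] at h1 h2 ⊢
    have h4 := mul_le_mul_of_nonneg_left h2 (sub_nonneg.2 ht.2)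
    refine le_of_mul_le_mul_left ?_ ht.1
    linarith
  have h0 : (fun t => DcSupPred pX (W ψ) (mixSupPred (n := n) W (γ t)) - d ψ) 0 ≤
      ∑ φ, π φ * (DcSupPred pX (W φ) (mixSupPred (n := n) W π) - d φ) := by
    have hclos : (0 : ℝ) ∈ closure (Set.Ioc 0 1) := by
      rw [closure_Ioc zero_ne_one]; simp
    have : (nhdsWithin (0 : ℝ) (Set.Ioc 0 1)).NeBot := mem_closure_iff_nhdsWithin_neBot.1 hclos
    exact le_of_tendsto ((hcont 0 (by simp)).mono Set.Ioc_subset_Icc_self)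
      (eventually_nhdsWithin_of_forall hle)
  simpa only [hγ0] using h0

end Mixture

/-- Theorem 6, supervised setting. -/
theorem supervised_minmax_regret
    {X Y F : Type*} [Fintype X] [Nonempty X] [Fintype Y] [Nonempty Y]
    [Fintype F] [Nonempty F] {n : ℕ}
    (pX : X → ℝ) (hpX : IsPMF pX)
    (W : F → X → Y → ℝ) (hW : ∀ φ, IsChannel (W φ))
    (G : Finset F) (hG : G.Nonempty) :
    IsGreatest {r : ℝ | ∃ π, IsPrior π ∧
        r = mutualInfoSup (n := n) pX W π - ∑ φ, π φ * DcSupSet pX W G hG (W φ)}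
      (RstarSup (n := n) pX W G hG) ∧
    ∀ π, IsPrior π →
      IsLeast {r : ℝ | ∃ Q : (Fin (n + 1) → X) → (Fin n → Y) → Y → ℝ,
          IsSupPredictor Q ∧
          r = ∑ φ, π φ * (DcSupPred pX (W φ) Q - DcSupSet pX W G hG (W φ))}
        (∑ φ, π φ *
          (DcSupPred pX (W φ) (mixSupPred (n := n) W π) - DcSupSet pX W G hG (W φ))) := by
  have hset (π : F → ℝ) :
      mutualInfoSup (n := n) pX W π - ∑ φ, π φ * DcSupSet pX W G hG (W φ) = ∑ φ, π φ *
        (DcSupPred pX (W φ) (mixSupPred (n := n) W π) - DcSupSet pX W G hG (W φ)) := by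
    simp only [mutualInfoSup_eq, mul_sub, Finset.sum_sub_distrib]
  have hbayes (π : F → ℝ) (hπ : IsPrior π)
      (Q : (Fin (n + 1) → X) → (Fin n → Y) → Y → ℝ) (hQ : IsSupPredictor Q) :
      ∑ φ, π φ * (DcSupPred pX (W φ) (mixSupPred (n := n) W π) - DcSupSet pX W G hG (W φ)) ≤
        ∑ φ, π φ * (DcSupPred pX (W φ) Q - DcSupSet pX W G hG (W φ)) := by
    simp only [mul_sub, Finset.sum_sub_distrib]
    exact sub_le_sub_right (sum_DcSupPred_mixSupPred_le hpX hW hπ hQ) _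
  have hlower (π : F → ℝ) (hπ : IsPrior π) : ∀ r ∈ {r : ℝ |
      ∃ Q : (Fin (n + 1) → X) → (Fin n → Y) → Y → ℝ, IsSupPredictor Q ∧
        r = Finset.univ.sup' Finset.univ_nonempty fun φ =>
          G.sup' hG fun θ => supRegret pX (W φ) (W θ) Q},
      ∑ φ, π φ * (DcSupPred pX (W φ) (mixSupPred (n := n) W π) -
        DcSupSet pX W G hG (W φ)) ≤ r := by
    rintro r ⟨Q, hQ, rfl⟩
    refine (hbayes π hπ Q hQ).trans ?_
    simp only [sup'_supRegret hpX hW G hG _ hQ]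
    rw [← one_mul (Finset.sup' _ _ _), ← hπ.2, Finset.sum_mul]
    exact Finset.sum_le_sum fun φ _ => mul_le_mul_of_nonneg_left
      (Finset.le_sup' (fun φ => DcSupPred pX (W φ) Q - DcSupSet pX W G hG (W φ))
        (Finset.mem_univ φ)) (hπ.1 φ)
  refine ⟨?_, fun π hπ => ⟨⟨_, isSupPredictor_mixSupPred hW hπ, rfl⟩, ?_⟩⟩
  · obtain ⟨π, hπ, hmax⟩ := (isCompact_stdSimplex ℝ F).exists_isMaxOn
      (f := fun ρ => ∑ φ, ρ φ *
        (DcSupPred pX (W φ) (mixSupPred (n := n) W ρ) - DcSupSet pX W G hG (W φ)))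
      (by classical exact ⟨_, single_mem_stdSimplex ℝ (Classical.arbitrary F)⟩)
      (continuousOn_finsetSum _ fun φ _ => (continuous_apply φ).continuousOn.mul
        ((continuousOn_DcSupPred_mixSupPred hW φ).sub continuousOn_const))
    have hQ := isSupPredictor_mixSupPred (n := n) hW hπ
    have hmem : ∃ r, r ∈ {r : ℝ |
        ∃ Q : (Fin (n + 1) → X) → (Fin n → Y) → Y → ℝ, IsSupPredictor Q ∧
          r = Finset.univ.sup' Finset.univ_nonempty fun φ =>
            G.sup' hG fun θ => supRegret pX (W φ) (W θ) Q} := ⟨_, _, hQ, rfl⟩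
    refine ⟨⟨π, hπ, ?_⟩, ?_⟩
    · rw [hset]
      refine le_antisymm ((csInf_le ⟨_, hlower π hπ⟩ ⟨_, hQ, rfl⟩).trans ?_)
        (le_csInf hmem (hlower π hπ))
      simp only [sup'_supRegret hpX hW G hG _ hQ]
      exact Finset.sup'_le _ _ fun ψ _ => DcSupPred_sub_le_of_isMaxOn hpX hW _ hπ hmax ψ
    · rintro r ⟨ρ, hρ, rfl⟩
      rw [hset]
      exact le_csInf hmem (hlower ρ hρ)
  · rintro r ⟨Q, hQ, rfl⟩
    exact hbayes π hπ Q hQ
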